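/- In the setting of the finite-range approximating mechanism: with thresholds R̲ ≼ R^{1*} ≼ R¹ ≼ R^{2*} ≼ R² ≼ … as above, and with s the step function taking value t_F's dyadic lower bound constant on each interval [R^{k-1}, R^k) of the partition induced by t_F, one has s(R) ≤ t_G(R) for all R ∈ [R̲, R̄], where t_G is the payment component of the finite-range mechanism G defined by G = (0,0) on [R̲, R^{1*}), G = F(R^k) on [R^{k*}, R^{(k+1)*}), G = F(R̄) on the last interval. -/

import Mathlib

open Set MeasureTheory Filter Topology
open scoped ENNReal

noncomputable section

abbrev Bundle : Type := ℝ × ℝ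

/-- The set of allocations Z = [0,∞) × [0,1]. -/
def Z : Set Bundle := {p | 0 ≤ p.1 ∧ p.2 ∈ Set.Icc (0:ℝ) 1}

/-- A CM (continuous, monotone) preference on Z. -/
structure CMPref where
  R : Bundle → Bundle → Prop
  total : ∀ x ∈ Z, ∀ y ∈ Z, R x y ∨ R y x
  trans : ∀ x y z : Bundle, R x y → R y z → R x z
  moneyMono : ∀ t' t'' q : ℝ, (t', q) ∈ Z → (t'', q) ∈ Z → t' < t'' →
    R (t', q) (t'', q) ∧ ¬ R (t'', q) (t', q)
  qMono : ∀ t q' q'' : ℝ, (t, q') ∈ Z → (t, q'') ∈ Z → q' < q'' →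
    R (t, q'') (t, q') ∧ ¬ R (t, q') (t, q'')
  contUC : ∀ z ∈ Z, IsClosed {x | x ∈ Z ∧ R x z}
  contLC : ∀ z ∈ Z, IsClosed {x | x ∈ Z ∧ R z x}

/-- Indifference. -/
def CMPref.I (p : CMPref) (x y : Bundle) : Prop := p.R x y ∧ p.R y x

/-- Indifference class of x. -/
def IC (p : CMPref) (x : Bundle) : Set Bundle := {y | y ∈ Z ∧ p.I y x}

/-- Single-crossing property of two preferences. -/
def SingleCrossing (p p' : CMPref) : Prop :=
  ∀ x y z : Bundle, z ∈ IC p x ∩ IC p' y → IC p x ∩ IC p' y = {z}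

/-- x ≤ y on bundles: equal, or strictly smaller in both coordinates. -/
def bleq (x y : Bundle) : Prop := x = y ∨ (x.1 < y.1 ∧ x.2 < y.2)

/-- □(z) = bundles (in Z) below z. -/
def square (z : Bundle) : Set Bundle := {x | x ∈ Z ∧ bleq x z}

/-- Upper contour set within Z. -/
def UC (p : CMPref) (z : Bundle) : Set Bundle := {x | x ∈ Z ∧ p.R x z}

/-- p'' cuts p' from above at z. -/
def CutsAt (p' p'' : CMPref) (z : Bundle) : Prop :=
  square z ∩ UC p'' z ⊆ square z ∩ UC p' z

/-- p' ≺ p'' : p'' cuts p' from above at every bundle (and they are distinct). -/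
def Prec (p' p'' : CMPref) : Prop := p' ≠ p'' ∧ ∀ z ∈ Z, CutsAt p' p'' z

/-- p ≼ p'. -/
def PrecEq (p p' : CMPref) : Prop := Prec p p' ∨ p = p'

/-- Rich single-crossing domain. -/
def RichSC (D : Set CMPref) : Prop :=
  (∀ p ∈ D, ∀ p' ∈ D, p ≠ p' → SingleCrossing p p') ∧
  (∀ x ∈ Z, ∀ y ∈ Z, x.1 < y.1 → x.2 < y.2 → ∃ p ∈ D, p.I x y)

/-- Closed interval [a,b] within the domain D. -/
def OrdInterval (D : Set CMPref) (a b : CMPref) : Set CMPref :=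
  {p | p ∈ D ∧ PrecEq a p ∧ PrecEq p b}

/-- Strategy-proofness on a set of preferences. -/
def StrategyProofOn (S : Set CMPref) (F : CMPref → Bundle) : Prop :=
  ∀ p ∈ S, ∀ p' ∈ S, p.R (F p) (F p')

/-- Individual rationality on a set of preferences. -/
def IROn (S : Set CMPref) (F : CMPref → Bundle) : Prop :=
  ∀ p ∈ S, p.R (F p) ((0:ℝ), (0:ℝ))

theorem CMPref.refl (p : CMPref) {x : Bundle} (hx : x ∈ Z) : p.R x x :=
  (p.total x hx x hx).elim id id

theorem CMPref.of_not (p : CMPref) {x y : Bundle} (hx : x ∈ Z) (hy : y ∈ Z) (h : ¬ p.R x y) :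
    p.R y x :=
  (p.total x hx y hy).resolve_left h

theorem CMPref.money_anti (p : CMPref) {t t' c : ℝ} (h : (t, c) ∈ Z) (h' : (t', c) ∈ Z)
    (htt : t ≤ t') : p.R (t, c) (t', c) := by
  rcases htt.eq_or_lt with rfl | hlt
  · exact p.refl h
  · exact (p.moneyMono t t' c h h' hlt).1

/-- A bundle with more of the good and no larger payment is strictly better. -/
theorem CMPref.not_R_of_lt (p : CMPref) {x y : Bundle} (hx : x ∈ Z) (hy : y ∈ Z)
    (h1 : y.1 ≤ x.1) (h2 : x.2 < y.2) : ¬ p.R x y := by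
  obtain ⟨t, a⟩ := x
  obtain ⟨t', c⟩ := y
  intro h
  have hm : (t', a) ∈ Z := ⟨hy.1, hx.2⟩
  exact (p.qMono t' a c hm hy h2).2 (p.trans _ _ _ (p.money_anti hm hx h1) h)

/-- `x` is strictly better than `y` for `p` and strictly worse for `q`, where `y` has more of
the good. -/
def Separates (p q : CMPref) (x y : Bundle) : Prop :=
  x ∈ Z ∧ y ∈ Z ∧ x.2 < y.2 ∧ ¬ p.R y x ∧ ¬ q.R x y

/-- No two distinct bundles are indifferent for both preferences. -/
def NoCommonIndiff (p q : CMPref) : Prop :=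
  ∀ x ∈ Z, ∀ y ∈ Z, x ≠ y → p.I y x → ¬ q.I y x

theorem NoCommonIndiff.symm {p q : CMPref} (h : NoCommonIndiff p q) : NoCommonIndiff q p :=
  fun x hx y hy hne hq hp => h x hx y hy hne hp hq

theorem SingleCrossing.noCommonIndiff {p q : CMPref} (h : SingleCrossing p q) :
    NoCommonIndiff p q := by
  intro x hx y hy hne hp hq
  have hxx : x ∈ IC p x ∩ IC q x :=
    ⟨⟨hx, p.refl hx, p.refl hx⟩, ⟨hx, q.refl hx, q.refl hx⟩⟩
  have hyx : y ∈ IC p x ∩ IC q x := ⟨⟨hy, hp⟩, ⟨hy, hq⟩⟩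
  rw [h x x x hxx] at hyx
  exact hne hyx.symm

theorem Separates.fst_lt {p q : CMPref} {x y : Bundle} (h : Separates p q x y) : x.1 < y.1 := by
  by_contra! hle
  exact p.not_R_of_lt h.1 h.2.1 hle h.2.2.1 (p.of_not h.2.1 h.1 h.2.2.2.1)

theorem Separates.not_prec {p q : CMPref} {x y : Bundle} (h : Separates p q x y) :
    ¬ Prec q p := by
  intro hqp
  have hsq : x ∈ square y := ⟨h.1, Or.inr ⟨h.fst_lt, h.2.2.1⟩⟩
  exact h.2.2.2.2 (hqp.2 y h.2.1 ⟨hsq, h.1, p.of_not h.2.1 h.1 h.2.2.2.1⟩).2.2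

theorem CMPref.isOpen_not_better (p : CMPref) {x : Bundle} (hx : x ∈ Z) :
    IsOpen {y | ¬ (y ∈ Z ∧ p.R y x)} :=
  (p.contUC x hx).isOpen_compl

theorem CMPref.isOpen_not_worse (p : CMPref) {x : Bundle} (hx : x ∈ Z) :
    IsOpen {y | ¬ (y ∈ Z ∧ p.R x y)} :=
  (p.contLC x hx).isOpen_compl

/-- A weak separation of `x` and `z` becomes strict after slightly raising the payment. -/
theorem exists_separates_of_raise {p q : CMPref} {x z : Bundle} (hx : x ∈ Z) (hz : z ∈ Z)
    (h2 : x.2 < z.2) (hp : p.R x z) (hq : ¬ q.R x z) : ∃ t, Separates p q x (t, z.2) := by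
  have hcont : Continuous fun t : ℝ => ((t, z.2) : Bundle) := by fun_prop
  have hev := ((q.isOpen_not_worse hx).preimage hcont).mem_nhds
    (show z.1 ∈ _ from fun h => hq h.2)
  obtain ⟨t, ht, hzt⟩ := Filter.nonempty_of_mem
    (inter_mem (mem_nhdsWithin_of_mem_nhds hev) (self_mem_nhdsWithin : Ioi z.1 ∈ 𝓝[>] z.1))
  have htZ : (t, z.2) ∈ Z := ⟨hz.1.trans (le_of_lt hzt), hz.2⟩
  refine ⟨t, hx, htZ, h2, fun h => ?_, fun h => ht ⟨htZ, h⟩⟩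
  exact (p.moneyMono z.1 t z.2 hz htZ hzt).2 (p.trans _ _ _ h hp)

/-- A weak separation of `x` and `z` becomes strict after slightly lowering the payment. -/
theorem exists_separates_of_lower {p q : CMPref} {x z : Bundle} (hx : x ∈ Z) (hz : z ∈ Z)
    (h2 : x.2 < z.2) (hp : ¬ p.R z x) (hq : q.R z x) : ∃ t, Separates p q x (t, z.2) := by
  have hpos : 0 < z.1 := by
    by_contra! hle
    exact p.not_R_of_lt hx hz (hle.trans hx.1) h2 (p.of_not hz hx hp)
  have hcont : Continuous fun t : ℝ => ((t, z.2) : Bundle) := by fun_prop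
  have hev := ((p.isOpen_not_better hx).preimage hcont).mem_nhds
    (show z.1 ∈ _ from fun h => hp h.2)
  obtain ⟨t, ht, h0t, htz⟩ := Filter.nonempty_of_mem
    (inter_mem (mem_nhdsWithin_of_mem_nhds hev) (Ioo_mem_nhdsLT hpos))
  have htZ : (t, z.2) ∈ Z := ⟨h0t.le, hz.2⟩
  refine ⟨t, hx, htZ, h2, fun h => ht ⟨htZ, h⟩, fun h => ?_⟩
  exact (q.moneyMono t z.1 z.2 htZ hz htz).2 (q.trans _ _ _ hq h)

theorem CMPref.exists_indiff (q : CMPref) {x : Bundle} {t c : ℝ} (hx : x ∈ Z)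
    (ht : (t, c) ∈ Z) (hc : x.2 < c) (h : q.R x (t, c)) : ∃ r, (r, c) ∈ Z ∧ q.I (r, c) x := by
  have hcont : Continuous fun r : ℝ => ((r, c) : Bundle) := by fun_prop
  have hZ : ∀ r, 0 ≤ r → (r, c) ∈ Z := fun r hr => ⟨hr, ht.2⟩
  have hx1 := hZ x.1 hx.1
  obtain ⟨r, -, h1, h2⟩ := isPreconnected_closed_iff.1 (isPreconnected_Ici (a := (0 : ℝ))) _ _
    ((q.contUC x hx).preimage hcont) ((q.contLC x hx).preimage hcont)
    (fun r hr => (q.total _ (hZ r hr) x hx).imp (fun h => ⟨hZ r hr, h⟩) (fun h => ⟨hZ r hr, h⟩))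
    ⟨x.1, hx.1, hx1, q.of_not hx hx1 (q.not_R_of_lt hx hx1 le_rfl hc)⟩
    ⟨t, ht.1, ht, h⟩
  exact ⟨r, h1.1, h1.2, h2.2⟩

theorem NoCommonIndiff.exists_separates_of_R {p q : CMPref} (hN : NoCommonIndiff p q)
    {x : Bundle} {t c : ℝ} (hx : x ∈ Z) (ht : (t, c) ∈ Z) (hc : x.2 < c) (h : q.R x (t, c)) :
    ∃ r, Separates p q x (r, c) ∨ Separates q p x (r, c) := by
  obtain ⟨r, hr, hI⟩ := q.exists_indiff hx ht hc h
  by_cases h1 : p.R (r, c) x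
  · have h2 : ¬ p.R x (r, c) := fun h2 =>
      hN x hx _ hr (fun he => hc.ne (congrArg Prod.snd he)) ⟨h1, h2⟩ hI
    obtain ⟨r', hr'⟩ := exists_separates_of_raise hx hr hc hI.2 h2
    exact ⟨r', Or.inr hr'⟩
  · obtain ⟨r', hr'⟩ := exists_separates_of_lower hx hr hc h1 hI.1
    exact ⟨r', Or.inl hr'⟩

theorem NoCommonIndiff.exists_separates {p q : CMPref} (hN : NoCommonIndiff p q)
    {x : Bundle} (hx : x ∈ Z) (hx1 : x.2 < 1) :
    ∃ y, Separates p q x y ∨ Separates q p x y := by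
  have hcont : Continuous fun c : ℝ => ((x.1 + 1, c) : Bundle) := by fun_prop
  have hZ : (x.1 + 1, x.2) ∈ Z := ⟨by have := hx.1; change 0 ≤ x.1 + 1; linarith, hx.2⟩
  have hev := ((q.isOpen_not_better hx).preimage hcont).mem_nhds
    (show x.2 ∈ _ from fun h => (q.moneyMono x.1 (x.1 + 1) x.2 hx hZ (by linarith)).2 h.2)
  obtain ⟨c, hc, hxc, hc1⟩ := Filter.nonempty_of_mem
    (inter_mem (mem_nhdsWithin_of_mem_nhds hev) (Ioo_mem_nhdsGT hx1))
  have hcZ : (x.1 + 1, c) ∈ Z := ⟨hZ.1, hx.2.1.trans hxc.le, hc1.le⟩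
  obtain ⟨r, hr⟩ := hN.exists_separates_of_R hx hcZ hxc
    (q.of_not hcZ hx fun h => hc ⟨hcZ, h⟩)
  exact ⟨_, hr⟩

theorem Separates.not_swap_same_snd {p q : CMPref} {x : Bundle} {t t' c : ℝ}
    (h : Separates p q x (t, c)) (h' : Separates q p x (t', c)) : False := by
  obtain ⟨hx, hy, -, hp, hq⟩ := h
  obtain ⟨-, hy', -, hq', hp'⟩ := h'
  rcases le_total t t' with hle | hle
  · exact hp (p.trans _ _ _ (p.money_anti hy hy' hle) (p.of_not hx hy' hp'))
  · exact hq' (q.trans _ _ _ (q.money_anti hy' hy hle) (q.of_not hx hy hq))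

theorem NoCommonIndiff.not_swap_of_le {p q : CMPref} (hN : NoCommonIndiff p q)
    {x y y' : Bundle} (h : Separates p q x y) (h' : Separates q p x y') (hle : y.2 ≤ y'.2) :
    False := by
  have hx := h.1
  have hopen : ∀ p q : CMPref, IsOpen (⋃ t ∈ Ici (0 : ℝ), {c : ℝ |
      ¬ (((t, c) : Bundle) ∈ Z ∧ p.R (t, c) x) ∧ ¬ (((t, c) : Bundle) ∈ Z ∧ q.R x (t, c))}) := by
    intro p q
    refine isOpen_biUnion fun t _ => ?_
    have hcont : Continuous fun c : ℝ => ((t, c) : Bundle) := by fun_prop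
    exact ((p.isOpen_not_better hx).preimage hcont).inter
      ((q.isOpen_not_worse hx).preimage hcont)
  have hmem : ∀ (p q : CMPref) (t c : ℝ), Separates p q x (t, c) → c ∈ (⋃ t ∈ Ici (0 : ℝ), {c : ℝ |
      ¬ (((t, c) : Bundle) ∈ Z ∧ p.R (t, c) x) ∧ ¬ (((t, c) : Bundle) ∈ Z ∧ q.R x (t, c))}) := by
    intro p q t c hs
    exact mem_biUnion (show t ∈ Ici (0 : ℝ) from hs.2.1.1)
      ⟨fun h => hs.2.2.2.1 h.2, fun h => hs.2.2.2.2 h.2⟩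
  have hsep : ∀ (p q : CMPref) (c : ℝ), c ∈ Icc y.2 y'.2 → c ∈ (⋃ t ∈ Ici (0 : ℝ), {c : ℝ |
      ¬ (((t, c) : Bundle) ∈ Z ∧ p.R (t, c) x) ∧ ¬ (((t, c) : Bundle) ∈ Z ∧ q.R x (t, c))}) →
      ∃ t, Separates p q x (t, c) := by
    intro p q c hc hu
    obtain ⟨t, ht, h1, h2⟩ := mem_iUnion₂.1 hu
    have hZ : (t, c) ∈ Z := ⟨ht, h.2.1.2.1.trans hc.1, hc.2.trans h'.2.1.2.2⟩
    exact ⟨t, hx, hZ, h.2.2.1.trans_le hc.1, fun h => h1 ⟨hZ, h⟩, fun h => h2 ⟨hZ, h⟩⟩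
  obtain ⟨c, hc, hu, hv⟩ := (isPreconnected_Icc (a := y.2) (b := y'.2)) _ _
    (hopen p q) (hopen q p)
    (by
      intro c hc
      have hZ : (y'.1, c) ∈ Z := ⟨h'.2.1.1, h.2.1.2.1.trans hc.1, hc.2.trans h'.2.1.2.2⟩
      have hR : q.R x (y'.1, c) := by
        refine q.of_not hZ hx fun hcx => h'.2.2.2.1 (q.trans _ _ _ ?_ hcx)
        rcases hc.2.eq_or_lt with he | hlt
        · rw [he]; exact q.refl h'.2.1
        · exact (q.qMono _ _ _ hZ h'.2.1 hlt).1
      obtain ⟨r, hr | hr⟩ := hN.exists_separates_of_R hx hZ (h.2.2.1.trans_le hc.1) hR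
      · exact Or.inl (hmem _ _ _ _ hr)
      · exact Or.inr (hmem _ _ _ _ hr))
    ⟨y.2, ⟨le_rfl, hle⟩, hmem _ _ _ _ h⟩ ⟨y'.2, ⟨hle, le_rfl⟩, hmem _ _ _ _ h'⟩
  obtain ⟨t, ht⟩ := hsep _ _ c hc hu
  obtain ⟨t', ht'⟩ := hsep _ _ c hc hv
  exact ht.not_swap_same_snd ht'

theorem NoCommonIndiff.not_swap_same_fst {p q : CMPref} (hN : NoCommonIndiff p q)
    {x y y' : Bundle} (h : Separates p q x y) (h' : Separates q p x y') : False :=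
  (le_total y.2 y'.2).elim (hN.not_swap_of_le h h') (hN.symm.not_swap_of_le h' h)

theorem NoCommonIndiff.not_swap {p q : CMPref} (hN : NoCommonIndiff p q)
    {x y x' y' : Bundle} (h : Separates p q x y) (h' : Separates q p x' y') : False := by
  have hopen : ∀ p q : CMPref, IsOpen (⋃ y ∈ Z, {x : Bundle |
      x.2 < y.2 ∧ ¬ (x ∈ Z ∧ p.R y x) ∧ ¬ (x ∈ Z ∧ q.R x y)}) := by
    intro p q
    refine isOpen_biUnion fun y hy => ?_
    exact (isOpen_lt continuous_snd continuous_const).inter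
      ((p.isOpen_not_worse hy).inter (q.isOpen_not_better hy))
  have hmem : ∀ (p q : CMPref) (x y : Bundle), Separates p q x y → x ∈ (⋃ y ∈ Z, {x : Bundle |
      x.2 < y.2 ∧ ¬ (x ∈ Z ∧ p.R y x) ∧ ¬ (x ∈ Z ∧ q.R x y)}) := by
    intro p q x y hs
    exact mem_biUnion hs.2.1
      ⟨hs.2.2.1, fun h => hs.2.2.2.1 h.2, fun h => hs.2.2.2.2 h.2⟩
  have hsep : ∀ (p q : CMPref) (x : Bundle), x ∈ Z → x ∈ (⋃ y ∈ Z, {x : Bundle |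
      x.2 < y.2 ∧ ¬ (x ∈ Z ∧ p.R y x) ∧ ¬ (x ∈ Z ∧ q.R x y)}) → ∃ y, Separates p q x y := by
    intro p q x hx hu
    obtain ⟨y, hy, h1, h2, h3⟩ := mem_iUnion₂.1 hu
    exact ⟨y, hx, hy, h1, fun h => h2 ⟨hx, h⟩, fun h => h3 ⟨hx, h⟩⟩
  have hbase : ∀ x ∈ Ici (0 : ℝ) ×ˢ Ico (0 : ℝ) 1, x ∈ Z ∧ x.2 < 1 :=
    fun x hx => ⟨⟨hx.1, hx.2.1, hx.2.2.le⟩, hx.2.2⟩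
  have hof : ∀ (p q : CMPref) (x y : Bundle), Separates p q x y →
      x ∈ Ici (0 : ℝ) ×ˢ Ico (0 : ℝ) 1 :=
    fun p q x y hs => ⟨hs.1.1, hs.1.2.1, hs.2.2.1.trans_le hs.2.1.2.2⟩
  obtain ⟨w, hw, hu, hv⟩ := (isPreconnected_Ici.prod isPreconnected_Ico :
      IsPreconnected (Ici (0 : ℝ) ×ˢ Ico (0 : ℝ) 1)) _ _ (hopen p q) (hopen q p)
    (by
      intro w hw
      obtain ⟨z, hz | hz⟩ := hN.exists_separates (hbase w hw).1 (hbase w hw).2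
      · exact Or.inl (hmem _ _ _ _ hz)
      · exact Or.inr (hmem _ _ _ _ hz))
    ⟨x, hof _ _ _ _ h, hmem _ _ _ _ h⟩ ⟨x', hof _ _ _ _ h', hmem _ _ _ _ h'⟩
  obtain ⟨z, hz⟩ := hsep _ _ w (hbase w hw).1 hu
  obtain ⟨z', hz'⟩ := hsep _ _ w (hbase w hw).1 hv
  exact hN.not_swap_same_fst hz hz'

theorem exists_separates_of_not_prec {p q : CMPref} (hne : p ≠ q) (h : ¬ Prec p q) :
    ∃ x y, Separates q p x y := by
  simp only [Prec, CutsAt, not_and, not_forall, not_subset] at h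
  obtain ⟨z, hz, x, ⟨hsq, hx, hq⟩, hnp⟩ := h hne
  have hp : ¬ p.R x z := fun hp => hnp ⟨hsq, hx, hp⟩
  rcases hsq.2 with rfl | ⟨-, h2⟩
  · exact absurd (p.refl hx) hp
  · obtain ⟨t, ht⟩ := exists_separates_of_raise hx hz h2 hq hp
    exact ⟨x, _, ht⟩

theorem RichSC.prec_or_precEq {D : Set CMPref} (hD : RichSC D) {p q : CMPref} (hp : p ∈ D)
    (hq : q ∈ D) : Prec p q ∨ PrecEq q p := by
  by_contra! h
  have hne : p ≠ q := fun he => h.2 (Or.inr he.symm)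
  obtain ⟨x, y, hs⟩ := exists_separates_of_not_prec hne h.1
  obtain ⟨x', y', hs'⟩ := exists_separates_of_not_prec hne.symm fun hqp => h.2 (Or.inl hqp)
  exact (hD.1 p hp q hq hne).noCommonIndiff.not_swap hs' hs

theorem RichSC.prec_asymm {D : Set CMPref} (hD : RichSC D) {p q : CMPref} (hp : p ∈ D)
    (hq : q ∈ D) (hpq : Prec p q) : ¬ Prec q p := by
  intro hqp
  have h0 : ((0 : ℝ), (0 : ℝ)) ∈ Z := ⟨le_rfl, le_rfl, zero_le_one⟩
  obtain ⟨y, hy | hy⟩ := (hD.1 p hp q hq hpq.1).noCommonIndiff.exists_separates h0 zero_lt_one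
  · exact hy.not_prec hqp
  · exact hy.not_prec hpq

theorem RichSC.prec_of_prec_of_precEq {D : Set CMPref} (hD : RichSC D) {p q r : CMPref}
    (hp : p ∈ D) (hq : q ∈ D) (hpq : Prec p q) (hqr : PrecEq q r) : Prec p r := by
  rcases hqr with hqr | rfl
  · refine ⟨?_, fun z hz => (hqr.2 z hz).trans (hpq.2 z hz)⟩
    rintro rfl
    exact hD.prec_asymm hp hq hpq hqr
  · exact hpq

theorem stmt12 (D : Set CMPref) (hD : RichSC D) (Rlo Rhi : CMPref)
    (hloD : Rlo ∈ D) (hhiD : Rhi ∈ D)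
    (F : CMPref → Bundle) (hFZ : ∀ p ∈ OrdInterval D Rlo Rhi, F p ∈ Z)
    (hSP : StrategyProofOn (OrdInterval D Rlo Rhi) F)
    (hIR : IROn (OrdInterval D Rlo Rhi) F)
    (hF0 : F Rlo = ((0:ℝ), (0:ℝ)))
    (m : ℕ) (hm : 1 ≤ m) (Rk Rstar : ℕ → CMPref)
    (hmemk : ∀ k, 1 ≤ k → k ≤ m → Rk k ∈ OrdInterval D Rlo Rhi)
    (hmems : ∀ k, 1 ≤ k → k ≤ m + 1 → Rstar k ∈ OrdInterval D Rlo Rhi)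
    (hchain : ∀ k, 1 ≤ k → k < m → Prec (Rk k) (Rk (k+1)))
    (hlo1 : Prec Rlo (Rk 1)) (hhi1 : Prec (Rk m) Rhi)
    (hint1 : PrecEq Rlo (Rstar 1))
    (hint2 : ∀ k, 1 ≤ k → k ≤ m → PrecEq (Rstar k) (Rk k) ∧ PrecEq (Rk k) (Rstar (k+1)))
    (hint3 : PrecEq (Rstar (m+1)) Rhi)
    (G : CMPref → Bundle)
    (hG1 : ∀ p ∈ OrdInterval D Rlo Rhi, Prec p (Rstar 1) → G p = ((0:ℝ), (0:ℝ)))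
    (hG2 : ∀ p ∈ OrdInterval D Rlo Rhi, ∀ k, 1 ≤ k → k ≤ m →
      PrecEq (Rstar k) p → Prec p (Rstar (k+1)) → G p = F (Rk k))
    (hG3 : ∀ p ∈ OrdInterval D Rlo Rhi, PrecEq (Rstar (m+1)) p → G p = F Rhi)
    (s : CMPref → ℝ)
    (hsF : ∀ p ∈ OrdInterval D Rlo Rhi, s p ≤ (F p).1)
    (hsmono : ∀ p ∈ OrdInterval D Rlo Rhi, ∀ q ∈ OrdInterval D Rlo Rhi,
      PrecEq p q → s p ≤ s q)
    (hs0 : ∀ p ∈ OrdInterval D Rlo Rhi, Prec p (Rk 1) → s p = 0)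
    (hsconst : ∀ k, 1 ≤ k → k < m → ∀ p ∈ OrdInterval D Rlo Rhi,
      PrecEq (Rk k) p → Prec p (Rk (k+1)) → s p = s (Rk k))
    (hslast : ∀ p ∈ OrdInterval D Rlo Rhi, PrecEq (Rk m) p → s p = s (Rk m)) :
    ∀ p ∈ OrdInterval D Rlo Rhi, s p ≤ (G p).1 := by
  intro p hp
  have hhi : Rhi ∈ OrdInterval D Rlo Rhi :=
    ⟨hhiD, Or.inl (hD.prec_of_prec_of_precEq hloD (hmemk 1 le_rfl hm).1 hlo1
      (hmemk 1 le_rfl hm).2.2), Or.inr rfl⟩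
  have key : ∀ k, 1 ≤ k → k ≤ m + 1 → Prec p (Rstar k) → s p ≤ (G p).1 := by
    intro k hk
    induction k, hk using Nat.le_induction with
    | base =>
      intro _ hlt
      rw [hG1 p hp hlt, hs0 p hp (hD.prec_of_prec_of_precEq hp.1
        (hmems 1 le_rfl (by omega)).1 hlt (hint2 1 le_rfl hm).1)]
    | succ k hk ih =>
      intro hkm hlt
      have hkm' : k ≤ m := by omega
      rcases hD.prec_or_precEq hp.1 (hmems k hk (by omega)).1 with hpk | hkp
      · exact ih (by omega) hpk
      rw [hG2 p hp k hk hkm' hkp hlt]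
      have hRk := hmemk k hk hkm'
      refine le_trans ?_ (hsF _ hRk)
      rcases hD.prec_or_precEq hp.1 hRk.1 with h | h
      · exact hsmono p hp _ hRk (Or.inl h)
      · rcases hkm'.eq_or_lt with rfl | hlt'
        · exact (hslast p hp h).le
        · exact (hsconst k hk hlt' p hp h (hD.prec_of_prec_of_precEq hp.1
            (hmems (k + 1) (by omega) hkm).1 hlt (hint2 (k + 1) (by omega) hlt').1)).le
  rcases hD.prec_or_precEq hp.1 (hmems (m + 1) (by omega) le_rfl).1 with h | h
  · exact key (m + 1) (by omega) le_rfl h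
  · rw [hG3 p hp h]
    exact (hsmono p hp _ hhi hp.2.2).trans (hsF _ hhi)
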